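/- The presented group N' has exactly one normal subgroup of index 4 whose abelianization is infinite cyclic (isomorphic to ℤ). -/

import Mathlib

/-- The generator `a` of the free group on four generators. -/
private def a : FreeGroup (Fin 4) := FreeGroup.of 0

/-- The generator `b` of the free group on four generators. -/
private def b : FreeGroup (Fin 4) := FreeGroup.of 1

/-- The generator `σ` of the free group on four generators. -/
private def s : FreeGroup (Fin 4) := FreeGroup.of 2

/-- The generator `τ` of the free group on four generators. -/
private def t : FreeGroup (Fin 4) := FreeGroup.of 3

/-- The word `w' = a·b·a⁻¹·b⁻¹·a⁻¹·b·a·b⁻¹·a⁻¹·b⁻¹·a·b`. -/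
private def w' : FreeGroup (Fin 4) :=
  a * b * a⁻¹ * b⁻¹ * a⁻¹ * b * a * b⁻¹ * a⁻¹ * b⁻¹ * a * b

/-- The word `w'* = b·a·b⁻¹·a⁻¹·b⁻¹·a·b·a⁻¹·b⁻¹·a⁻¹·b·a`. -/
private def w'star : FreeGroup (Fin 4) :=
  b * a * b⁻¹ * a⁻¹ * b⁻¹ * a * b * a⁻¹ * b⁻¹ * a⁻¹ * b * a

/-- The group `N'`, the normalizer in `Isom(ℍ³)` of the fundamental group `Γ'` of the
0-surgery on the knot 6₃, with generators `a, b, σ, τ`. -/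
private abbrev N' : Type :=
  PresentedGroup
    ({w' * a * w'⁻¹ * b⁻¹, w' * w'star, s * t * s⁻¹ * t⁻¹,
      s * a * s⁻¹ * b⁻¹, s * b * s⁻¹ * a⁻¹, t * a * t⁻¹ * a, t * b * t⁻¹ * b,
      s ^ 2, t ^ 2, (s * t) ^ 2} : Set (FreeGroup (Fin 4)))

/-- The word `w'` evaluated at two elements of a group. -/
private def wd {G : Type*} [Group G] (x y : G) : G :=
  x * y * x⁻¹ * y⁻¹ * x⁻¹ * y * x * y⁻¹ * x⁻¹ * y⁻¹ * x * y

private lemma exists_hom {G : Type*} [Group G] (x y u v : G)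
    (h1 : wd x y * x * (wd x y)⁻¹ * y⁻¹ = 1) (h2 : wd x y * wd y x = 1)
    (h3 : u * v * u⁻¹ * v⁻¹ = 1) (h4 : u * x * u⁻¹ * y⁻¹ = 1) (h5 : u * y * u⁻¹ * x⁻¹ = 1)
    (h6 : v * x * v⁻¹ * x = 1) (h7 : v * y * v⁻¹ * y = 1) (h8 : u ^ 2 = 1) (h9 : v ^ 2 = 1)
    (h10 : (u * v) ^ 2 = 1) :
    ∃ φ : N' →* G, φ (PresentedGroup.of 0) = x ∧ φ (PresentedGroup.of 1) = y ∧
      φ (PresentedGroup.of 2) = u ∧ φ (PresentedGroup.of 3) = v := by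
  refine ⟨PresentedGroup.toGroup (f := ![x, y, u, v]) ?_, ?_, ?_, ?_, ?_⟩
  · intro r hr
    simp only [Set.mem_insert_iff, Set.mem_singleton_iff] at hr
    rcases hr with h | h | h | h | h | h | h | h | h | h <;> subst h <;>
      simp only [w', w'star, a, b, s, t, map_mul, map_inv, map_pow, FreeGroup.lift_apply_of] <;>
      simp only [Matrix.cons_val]
    · exact h1
    · exact h2
    · exact h3
    · exact h4
    · exact h5
    · exact h6
    · exact h7
    · exact h8
    · exact h9
    · exact h10
  all_goals rw [PresentedGroup.toGroup.of]; rfl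

private def A : N' := PresentedGroup.of 0
private def B : N' := PresentedGroup.of 1
private def S : N' := PresentedGroup.of 2
private def T : N' := PresentedGroup.of 3

private lemma rels : wd A B * A * (wd A B)⁻¹ * B⁻¹ = 1 ∧ S * T * S⁻¹ * T⁻¹ = 1 ∧
    S * A * S⁻¹ * B⁻¹ = 1 ∧ S * B * S⁻¹ * A⁻¹ = 1 ∧ T * A * T⁻¹ * A = 1 ∧ T * B * T⁻¹ * B = 1 ∧
    S ^ 2 = 1 ∧ T ^ 2 = 1 := by
  refine ⟨?_, ?_, ?_, ?_, ?_, ?_, ?_, ?_⟩ <;>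
    refine PresentedGroup.one_of_mem (rels := ({w' * a * w'⁻¹ * b⁻¹, w' * w'star, s * t * s⁻¹ * t⁻¹,
      s * a * s⁻¹ * b⁻¹, s * b * s⁻¹ * a⁻¹, t * a * t⁻¹ * a, t * b * t⁻¹ * b,
      s ^ 2, t ^ 2, (s * t) ^ 2} : Set (FreeGroup (Fin 4)))) (x := ?_) ?_
  all_goals first
    | exact Or.inl rfl
    | exact Or.inr (Or.inr (Or.inl rfl))
    | skip
  all_goals simp [a, b, s, t]

private lemma relW : wd A B * A * (wd A B)⁻¹ * B⁻¹ = 1 := rels.1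
private lemma relST : S * T = T * S := by
  have := rels.2.1
  rwa [mul_inv_eq_one, mul_inv_eq_iff_eq_mul] at this
private lemma relSA : S * A * S⁻¹ = B := mul_inv_eq_one.1 rels.2.2.1
private lemma relSB : S * B * S⁻¹ = A := mul_inv_eq_one.1 rels.2.2.2.1
private lemma relTA : T * A * T⁻¹ = A⁻¹ := mul_eq_one_iff_eq_inv.1 rels.2.2.2.2.1
private lemma relTB : T * B * T⁻¹ = B⁻¹ := mul_eq_one_iff_eq_inv.1 rels.2.2.2.2.2.1
private lemma relS : S ^ 2 = 1 := rels.2.2.2.2.2.2.1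
private lemma relT : T ^ 2 = 1 := rels.2.2.2.2.2.2.2
private lemma invS : S⁻¹ = S := by
  rw [inv_eq_iff_mul_eq_one, ← sq, relS]
private lemma invT : T⁻¹ = T := by
  rw [inv_eq_iff_mul_eq_one, ← sq, relT]

private lemma gen (L : Subgroup N') (hA : A ∈ L) (hB : B ∈ L) (hS : S ∈ L) (hT : T ∈ L) (n : N') :
    n ∈ L := by
  have h : (⊤ : Subgroup N') ≤ L := by
    rw [← PresentedGroup.closure_range_of, Subgroup.closure_le]
    rintro _ ⟨i, rfl⟩
    fin_cases i
    · exact hA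
    · exact hB
    · exact hS
    · exact hT
  exact h trivial

/-- The parity map onto `(ℤ/2)³`. -/
private lemma exists_par : ∃ φ : N' →* Multiplicative (ZMod 2 × ZMod 2 × ZMod 2),
    φ A = .ofAdd (1, 0, 0) ∧ φ B = .ofAdd (1, 0, 0) ∧ φ S = .ofAdd (0, 1, 0) ∧
      φ T = .ofAdd (0, 0, 1) := by
  apply exists_hom <;> decide

/-- The map with kernel `Γ'`. -/
private lemma exists_pi : ∃ φ : N' →* Multiplicative (ZMod 2 × ZMod 2),
    φ A = 1 ∧ φ B = 1 ∧ φ S = .ofAdd (1, 0) ∧ φ T = .ofAdd (0, 1) := by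
  apply exists_hom <;> decide

/-- The representation onto the dihedral group of order 26. -/
private lemma exists_dih : ∃ φ : N' →* DihedralGroup 13,
    φ A = .sr 1 ∧ φ B = .sr (-1) ∧ φ S = .sr 0 ∧ φ T = 1 := by
  apply exists_hom <;> decide

/-- The representation onto the infinite dihedral group, acting on `ℤ`. -/
private lemma exists_inf : ∃ φ : N' →* Equiv.Perm ℤ,
    φ A = Equiv.addRight 1 ∧ φ B = Equiv.addRight 1 ∧ φ S = 1 ∧ φ T = Equiv.neg ℤ := by
  apply exists_hom
  · simp only [wd]; group
  · simp only [wd]; group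
  · group
  · group
  · group
  · ext x; simp [Equiv.Perm.mul_apply, Equiv.Perm.inv_def]
  · ext x; simp [Equiv.Perm.mul_apply, Equiv.Perm.inv_def]
  · simp
  · ext x; simp [sq]
  · ext x; simp [sq]

private def H : Subgroup N' := Subgroup.closure {A, B}
private lemma A_mem : A ∈ H := Subgroup.subset_closure (by simp)
private lemma B_mem : B ∈ H := Subgroup.subset_closure (by simp)

private lemma conj_mem (n : N') (hA : n * A * n⁻¹ ∈ H) (hB : n * B * n⁻¹ ∈ H) :
    ∀ h ∈ H, n * h * n⁻¹ ∈ H := by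
  have : H ≤ H.comap (MulAut.conj n).toMonoidHom := by
    conv_lhs => unfold H
    rw [Subgroup.closure_le]
    rintro x (rfl | rfl)
    · simpa using hA
    · simpa using hB
  intro h hh
  simpa using this hh

private lemma H_normal : H.Normal := by
  have key : ∀ n : N', n ∈ Subgroup.normalizer H := by
    have inv : ∀ n : N', n⁻¹ = n → (∀ h ∈ H, n * h * n⁻¹ ∈ H) → n ∈ Subgroup.normalizer H := by
      intro n hn h
      rw [Subgroup.mem_normalizer_iff]
      intro x
      refine ⟨h x, fun hx => ?_⟩
      have := h _ hx
      have e : n * (n * x * n⁻¹) * n⁻¹ = x := by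
        nth_rewrite 1 [← hn]
        nth_rewrite 3 [← hn]
        group
      rwa [e] at this
    apply gen
    · exact Subgroup.le_normalizer A_mem
    · exact Subgroup.le_normalizer B_mem
    · apply inv _ invS
      apply conj_mem
      · rw [relSA]; exact B_mem
      · rw [relSB]; exact A_mem
    · apply inv _ invT
      apply conj_mem
      · rw [relTA]; exact inv_mem A_mem
      · rw [relTB]; exact inv_mem B_mem
  exact Subgroup.normalizer_eq_top_iff.1 (eq_top_iff.2 fun n _ => key n)

/-- Normal form modulo `H`. -/
private lemma mod_H (n : N') : ∃ i j : ℤ, n * (S ^ i * T ^ j) ∈ H := by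
  have := H_normal
  have hc : Commute (QuotientGroup.mk' H S) (QuotientGroup.mk' H T) := by
    have : Commute S T := relST
    exact this.map _
  let L : Subgroup N' :=
    { carrier := {n | ∃ i j : ℤ, QuotientGroup.mk' H n =
        (QuotientGroup.mk' H S) ^ i * (QuotientGroup.mk' H T) ^ j}
      one_mem' := ⟨0, 0, by simp⟩
      mul_mem' := by
        rintro x y ⟨i, j, h⟩ ⟨k, l, h'⟩
        refine ⟨i + k, j + l, ?_⟩
        rw [map_mul, h, h', zpow_add, zpow_add]
        have := (hc.zpow_zpow k j).eq
        simp only [mul_assoc]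
        rw [← mul_assoc (_ ^ j), ← this]
        simp only [mul_assoc]
      inv_mem' := by
        rintro x ⟨i, j, h⟩
        refine ⟨-i, -j, ?_⟩
        rw [map_inv, h, mul_inv_rev, ← zpow_neg, ← zpow_neg]
        exact ((hc.zpow_zpow _ _).eq).symm }
  have hA : QuotientGroup.mk' H A = 1 := (QuotientGroup.eq_one_iff _).2 A_mem
  have hB : QuotientGroup.mk' H B = 1 := (QuotientGroup.eq_one_iff _).2 B_mem
  obtain ⟨i, j, h⟩ := gen L ⟨0, 0, by simpa using hA⟩ ⟨0, 0, by simpa using hB⟩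
    ⟨1, 0, by simp⟩ ⟨0, 1, by simp⟩ n
  refine ⟨-i, -j, ?_⟩
  have : QuotientGroup.mk' H (n * (S ^ (-i) * T ^ (-j))) = 1 := by
    rw [map_mul, map_mul, map_zpow, map_zpow, h, (hc.zpow_zpow _ _).eq]
    group
  exact (QuotientGroup.eq_one_iff _).1 this

private lemma zpow_cases {G : Type*} [Group G] (x : G) (hx : x ^ 2 = 1) (i : ℤ) :
    (Even i ∧ x ^ i = 1) ∨ (Odd i ∧ x ^ i = x) := by
  have h2 : x ^ (2 : ℤ) = 1 := by exact_mod_cast hx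
  rcases Int.even_or_odd i with h | h
  · left
    refine ⟨h, ?_⟩
    obtain ⟨k, rfl⟩ := h
    rw [← two_mul, zpow_mul, h2, one_zpow]
  · right
    refine ⟨h, ?_⟩
    obtain ⟨k, rfl⟩ := h
    rw [zpow_add, zpow_mul, h2, one_zpow, one_mul, zpow_one]

private lemma H_index : H.index = 4 := by
  obtain ⟨φ, hA, hB, hS, hT⟩ := exists_pi
  have hker : φ.ker = H := by
    apply le_antisymm
    · intro n hn
      obtain ⟨i, j, h⟩ := mod_H n
      have h' : φ (n * (S ^ i * T ^ j)) = 1 := by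
        have : H ≤ φ.ker := by
          unfold H
          rw [Subgroup.closure_le]
          rintro x (rfl | rfl)
          · exact hA
          · exact hB
        exact this h
      rw [map_mul, MonoidHom.mem_ker.1 hn, one_mul] at h'
      rcases zpow_cases S relS i with ⟨-, hi⟩ | ⟨-, hi⟩ <;>
      rcases zpow_cases T relT j with ⟨-, hj⟩ | ⟨-, hj⟩ <;>
      rw [hi, hj] at h h' <;> simp only [map_mul, map_one, hS, hT] at h'
      · simpa using h
      all_goals exact absurd h' (by decide)
    · unfold H
      rw [Subgroup.closure_le]
      rintro x (rfl | rfl)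
      · exact hA
      · exact hB
  rw [← hker, Subgroup.index_ker]
  have : φ.range = ⊤ := by
    rw [eq_top_iff]
    rintro x -
    have : ∀ x : Multiplicative (ZMod 2 × ZMod 2),
      x = φ 1 ∨ x = φ S ∨ x = φ T ∨ x = φ (S * T) := by
      rw [map_mul, map_one, hS, hT]
      decide
    rcases this x with h | h | h | h <;> exact ⟨_, h.symm⟩
  rw [this, Subgroup.card_top, Nat.card_eq_fintype_card]
  rfl

private lemma H_ab : Nonempty (Abelianization H ≃* Multiplicative ℤ) := by
  obtain ⟨φ, hA, hB, -, -⟩ := exists_inf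
  have tr : ∀ n ∈ H, ∀ x : ℤ, φ n x = φ n 0 + x := by
    intro n hn
    induction hn using Subgroup.closure_induction with
    | mem n h =>
      rcases h with rfl | rfl
      · intro x; rw [hA]; simp [add_comm]
      · intro x; rw [hB]; simp [add_comm]
    | one => simp
    | mul x y _ _ hx hy =>
      intro z
      rw [map_mul, Equiv.Perm.mul_apply, Equiv.Perm.mul_apply, hx, hy, hx (φ y 0)]
      ring
    | inv x _ hx =>
      intro z
      rw [map_inv, Equiv.Perm.inv_eq_iff_eq, hx]
      have := hx ((φ x)⁻¹ 0)
      have h0 : φ x ((φ x)⁻¹ 0) = 0 := (φ x).apply_symm_apply 0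
      rw [h0] at this
      linarith
  let ψ : H →* Multiplicative ℤ :=
    { toFun := fun n => .ofAdd (φ n 0)
      map_one' := by simp
      map_mul' := by
        intro x y
        rw [← ofAdd_add]
        congr 1
        rw [Subgroup.coe_mul, map_mul, Equiv.Perm.mul_apply, tr _ x.2] }
  let A0 : H := ⟨A, A_mem⟩
  let B0 : H := ⟨B, B_mem⟩
  have hψ : ψ A0 = .ofAdd 1 := by
    change Multiplicative.ofAdd (φ A 0) = _
    rw [hA]; simp
  have hAB : Abelianization.of A0 = Abelianization.of B0 := by
    have h : wd A0 B0 * A0 * (wd A0 B0)⁻¹ * B0⁻¹ = 1 := Subtype.ext relW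
    have := congrArg Abelianization.of h
    rw [map_mul, map_mul, map_mul, map_inv, map_inv, map_one, mul_inv_cancel_comm,
      mul_inv_eq_one] at this
    exact this
  have gen0 : ∀ n (hn : n ∈ H), ∃ i : ℤ, Abelianization.of (⟨n, hn⟩ : H) = Abelianization.of A0 ^ i := by
    intro n hn
    induction hn using Subgroup.closure_induction with
    | mem n h =>
      rcases h with rfl | rfl
      · exact ⟨1, by rw [zpow_one]⟩
      · exact ⟨1, by rw [zpow_one, hAB]⟩
    | one => exact ⟨0, by rw [zpow_zero]; exact map_one _⟩
    | mul x y hx' hy' hx hy =>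
      obtain ⟨i, hi⟩ := hx
      obtain ⟨j, hj⟩ := hy
      refine ⟨i + j, ?_⟩
      rw [zpow_add, ← hi, ← hj, ← map_mul]
      rfl
    | inv x hx' hx =>
      obtain ⟨i, hi⟩ := hx
      refine ⟨-i, ?_⟩
      rw [zpow_neg, ← hi, ← map_inv]
      rfl
  refine ⟨MulEquiv.ofBijective (Abelianization.lift ψ) ⟨?_, ?_⟩⟩
  · rw [injective_iff_map_eq_one]
    intro x hx
    obtain ⟨⟨n, hn⟩, rfl⟩ := QuotientGroup.mk_surjective x
    obtain ⟨i, hi⟩ := gen0 n hn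
    change Abelianization.of (⟨n, hn⟩ : H) = 1
    change Abelianization.lift ψ (Abelianization.of (⟨n, hn⟩ : H)) = 1 at hx
    rw [hi, map_zpow, Abelianization.lift_apply_of, hψ, ← ofAdd_zsmul, ofAdd_eq_one] at hx
    have : i = 0 := by simpa using hx
    rw [hi, this, zpow_zero]
  · intro x
    refine ⟨Abelianization.of A0 ^ x.toAdd, ?_⟩
    rw [map_zpow, Abelianization.lift_apply_of, hψ, ← ofAdd_zsmul]
    simp

/-- If `x ∈ K` dies in `ℤ = K^ab`, it dies under every map whose restriction to `K` has
commutative image. -/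
private lemma dies {K : Subgroup N'} (e : Abelianization K ≃* Multiplicative ℤ) (x : K)
    (hx : e (Abelianization.of x) = 1) {G : Type*} [Group G] (φ : N' →* G)
    (hc : ∀ k ∈ K, ∀ l ∈ K, φ k * φ l = φ l * φ k) : φ x = 1 := by
  have h1 : Abelianization.of x = 1 := by simpa using hx
  have h2 : x ∈ commutator K := by
    rw [← Abelianization.ker_of]
    exact h1
  have h3 : commutator K ≤ (φ.comp K.subtype).ker := by
    rw [commutator_def, Subgroup.commutator_le]
    intro k _ l _
    rw [MonoidHom.mem_ker, map_commutatorElement, commutatorElement_eq_one_iff_mul_comm]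
    exact hc _ k.2 _ l.2
  exact h3 h2

private lemma sq_dies {K : Subgroup N'} (e : Abelianization K ≃* Multiplicative ℤ) (x : K)
    (hx : e (Abelianization.of (x ^ 2)) = 1) : e (Abelianization.of x) = 1 := by
  rw [map_pow, map_pow] at hx
  have : 2 • (e (Abelianization.of x)).toAdd = 0 := by
    rw [← toAdd_pow, hx]; rfl
  have h : (e (Abelianization.of x)).toAdd = 0 := by
    simpa using this
  exact h

private lemma y_dies {K : Subgroup N'} (f : K →* Multiplicative ℤ)
    (X Y Z : K) (hX : (X : N') = A * A) (hY : (Y : N') = B * A⁻¹) (hZ : (Z : N') = A * B) :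
    f Y = 1 := by
  have e1 : (Z * (Y * X)⁻¹ * (X⁻¹ * Z) * Y⁻¹ * (Y * X)⁻¹ * Z) *
      (X * Y * Z⁻¹ * (Y * X) * Z⁻¹ * (X⁻¹ * Z)⁻¹ * Y)⁻¹ * Y⁻¹ = 1 := by
    apply Subtype.ext
    simp only [Subgroup.coe_mul, Subgroup.coe_inv, hX, hY, hZ, Subgroup.coe_one]
    rw [← relW, wd]
    group
  have e2 : (X * Y * Z⁻¹ * (Y * X) * Z⁻¹ * (X⁻¹ * Z)⁻¹ * Y) *
      (X * (Z * (Y * X)⁻¹ * (X⁻¹ * Z) * Y⁻¹ * (Y * X)⁻¹ * Z)⁻¹ * X⁻¹) * (X * Z⁻¹) = 1 := by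
    apply Subtype.ext
    simp only [Subgroup.coe_mul, Subgroup.coe_inv, hX, hY, hZ, Subgroup.coe_one]
    have : (1 : N') = A * (wd A B * A * (wd A B)⁻¹ * B⁻¹) * A⁻¹ := by rw [relW]; group
    rw [this, wd]
    group
  have e1' := congrArg (fun k => (f k).toAdd) e1
  have e2' := congrArg (fun k => (f k).toAdd) e2
  simp only [map_mul, map_inv, map_one, toAdd_mul, toAdd_inv, toAdd_one] at e1' e2'
  have : (f Y).toAdd = 0 := by omega
  exact this

private lemma ab_form (n : N') {Q : Type*} [CommGroup Q] :
    ∃ i j k : ℤ, ∀ q : N' →* Q, q n = q A ^ i * q S ^ j * q T ^ k := by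
  let L : Subgroup N' :=
    { carrier := {n | ∃ i j k : ℤ, ∀ q : N' →* Q, q n = q A ^ i * q S ^ j * q T ^ k}
      one_mem' := ⟨0, 0, 0, by simp⟩
      mul_mem' := by
        rintro x y ⟨i, j, k, h⟩ ⟨i', j', k', h'⟩
        refine ⟨i + i', j + j', k + k', fun q => ?_⟩
        rw [map_mul, h, h', zpow_add, zpow_add, zpow_add]
        rw [mul_mul_mul_comm, mul_mul_mul_comm (q A ^ i)]
      inv_mem' := by
        rintro x ⟨i, j, k, h⟩
        refine ⟨-i, -j, -k, fun q => ?_⟩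
        rw [map_inv, h, mul_inv, mul_inv, zpow_neg, zpow_neg, zpow_neg] }
  refine gen L ⟨1, 0, 0, by simp⟩ ⟨1, 0, 0, fun q => ?_⟩ ⟨0, 1, 0, by simp⟩ ⟨0, 0, 1, by simp⟩ n
  rw [← relSA, map_mul, map_mul, map_inv, mul_inv_cancel_comm]
  simp

/-- The reflection parity on the dihedral group. -/
private def sgn : DihedralGroup 13 →* Multiplicative (ZMod 2) where
  toFun
    | .r _ => 1
    | .sr _ => .ofAdd 1
  map_one' := rfl
  map_mul' := by rintro (i | i) (j | j) <;> first | rfl | (change (1 : Multiplicative (ZMod 2)) = .ofAdd 1 * .ofAdd 1; decide)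

private lemma sgn_sr {z : ZMod 13} : sgn (.sr z) ≠ 1 := by
  change Multiplicative.ofAdd (1 : ZMod 2) ≠ 1
  decide

private lemma dih_ne : (.sr (-1) * (.sr 1)⁻¹ : DihedralGroup 13) ≠ 1 := by decide

private lemma four {Q : Type*} [CommGroup Q] (hQ : Nat.card Q = 4) (x y z : Q) (hx : x * x = 1)
    (hy : y * y = 1) (hz : z * z = 1) (h1 : x ≠ 1) (h2 : y ≠ 1) (h3 : z ≠ 1) (h4 : x * y ≠ 1)
    (h5 : x * z ≠ 1) (h6 : y * z ≠ 1) (h7 : x * y * z ≠ 1) : False := by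
  classical
  have : Finite Q := Nat.finite_of_card_ne_zero (by omega)
  have := Fintype.ofFinite Q
  have hxy : x ≠ y := by
    rintro rfl; exact h4 hx
  have hc : ({1, x, y, x * y} : Finset Q).card = Fintype.card Q := by
    rw [← Nat.card_eq_fintype_card, hQ]
    rw [Finset.card_insert_of_notMem, Finset.card_insert_of_notMem, Finset.card_insert_of_notMem,
      Finset.card_singleton]
    · simpa using h1
    · simp [hxy, h2]
    · simp [h1.symm, h2.symm, h4.symm]
  have hm : z ∈ ({1, x, y, x * y} : Finset Q) := by
    rw [Finset.eq_univ_of_card _ hc]; exact Finset.mem_univ _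
  simp only [Finset.mem_insert, Finset.mem_singleton] at hm
  rcases hm with h | h | h | h
  · exact h3 h
  · exact h5 (h ▸ hz)
  · exact h6 (h ▸ hz)
  · exact h7 (h ▸ hz)

private lemma uniq_aux (K : Subgroup N') {Q : Type*} [CommGroup Q] (hcard : Nat.card Q = 4)
    (q : N' →* Q) (hq : ∀ n, q n = 1 ↔ n ∈ K) (hK : K.index = 4)
    (e : Abelianization K ≃* Multiplicative ℤ) : K = H := by
  have qB : q B = q A := by
    rw [← relSA, map_mul, map_mul, map_inv, mul_inv_cancel_comm]
  have qA2 : q A * q A = 1 := by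
    have := congrArg q relTA
    rw [map_mul, map_mul, map_inv, mul_inv_cancel_comm, map_inv] at this
    exact mul_eq_one_iff_eq_inv.2 this
  have qS2 : q S * q S = 1 := by
    rw [← map_mul, ← sq, relS, map_one]
  have qT2 : q T * q T = 1 := by
    rw [← map_mul, ← sq, relT, map_one]
  obtain ⟨p, pA, pB, pS, pT⟩ := exists_par
  have noInv : ∀ x : N', x ^ 2 = 1 → p x ≠ 1 → x ∉ K := by
    intro x hx hp hxK
    apply hp
    refine dies e ⟨x, hxK⟩ (sq_dies e _ ?_) p (fun _ _ _ _ => mul_comm _ _)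
    have : (⟨x, hxK⟩ : K) ^ 2 = 1 := Subtype.ext hx
    rw [this, map_one, map_one]
  have ATA : A * T * A = T := by
    have := relTA
    rw [mul_inv_eq_iff_eq_mul] at this
    rw [mul_assoc, this]; group
  have hS : S ∉ K := noInv S relS (by rw [pS]; decide)
  have hT : T ∉ K := noInv T relT (by rw [pT]; decide)
  have hST : S * T ∉ K := by
    refine noInv _ ?_ (by rw [map_mul, pS, pT]; decide)
    have : Commute S T := relST
    rw [this.mul_pow, relS, relT, one_mul]
  have hAT : A * T ∉ K := by
    refine noInv _ ?_ (by rw [map_mul, pA, pT]; decide)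
    rw [sq, ← mul_assoc, ATA, ← sq, relT]
  have memX : A * A ∈ K := by rw [← hq, map_mul, qA2]
  have memY : B * A⁻¹ ∈ K := by rw [← hq, map_mul, map_inv, qB, mul_inv_cancel]
  have memZ : A * B ∈ K := by rw [← hq, map_mul, qB, qA2]
  have hY : e (Abelianization.of ⟨B * A⁻¹, memY⟩) = 1 :=
    y_dies (e.toMonoidHom.comp Abelianization.of) ⟨_, memX⟩ ⟨_, memY⟩ ⟨_, memZ⟩ rfl rfl rfl
  have hAST : A * S * T ∉ K := by
    intro h
    have : p (A * S * T) = 1 := by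
      refine dies e ⟨_, h⟩ (sq_dies e _ ?_) p (fun _ _ _ _ => mul_comm _ _)
      have : (⟨A * S * T, h⟩ : K) ^ 2 = (⟨B * A⁻¹, memY⟩ : K)⁻¹ := by
        apply Subtype.ext
        change (A * S * T) ^ 2 = (B * A⁻¹)⁻¹
        have h1 : S * T * A = B⁻¹ * (S * T) := by
          have h2 : T * A = A⁻¹ * T := mul_inv_eq_iff_eq_mul.1 relTA
          have h3 : S * A⁻¹ = B⁻¹ * S := by
            rw [← relSA]; group
          rw [mul_assoc, h2, ← mul_assoc, h3, mul_assoc]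
        have h4 : S * T * (S * T) = 1 := by
          have : Commute S T := relST
          rw [← sq, this.mul_pow, relS, relT, one_mul]
        calc (A * S * T) ^ 2 = A * (S * T * A) * (S * T) := by rw [sq]; simp only [mul_assoc]
          _ = A * B⁻¹ * (S * T * (S * T)) := by rw [h1]; simp only [mul_assoc]
          _ = _ := by rw [h4]; group
      rw [this, map_inv, map_inv, hY, inv_one]
    rw [map_mul, map_mul, pA, pS, pT] at this
    exact absurd this (by decide)
  have hA : A ∈ K := by
    by_contra hA
    have hAS : A * S ∉ K := by
      intro h
      obtain ⟨ρ, rA, rB, rS, rT⟩ := exists_dih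
      have qAS : q A * q S = 1 := by rw [← map_mul, hq]; exact h
      have qSA : q S = q A := by
        rw [← mul_right_inj (q A), qAS, qA2]
      -- parity of the dihedral representation on `K`
      have rot : ∀ k ∈ K, ∃ z, ρ k = .r z := by
        intro k hk
        obtain ⟨i, j, l, hf⟩ := ab_form k (Q := Q × Multiplicative (ZMod 2))
        have hf := hf (q.prod (sgn.comp ρ))
        rw [Prod.ext_iff] at hf
        obtain ⟨h1, h2⟩ := hf
        simp only [MonoidHom.prod_apply, MonoidHom.comp_apply, Prod.fst_mul, Prod.snd_mul,
          Prod.pow_fst, Prod.pow_snd, rA, rS, rT, qSA, (hq k).2 hk, map_one, one_zpow, mul_one,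
          ← zpow_add] at h1 h2
        rcases zpow_cases (q A) ((sq _).trans qA2) (i + j) with ⟨hi, -⟩ | ⟨-, hi⟩
        · rcases zpow_cases (sgn (.sr 1)) (by decide +revert) (i + j) with ⟨-, hs⟩ | ⟨hs, -⟩
          · have : sgn (ρ k) = 1 := by
              rw [h2, ← hs, zpow_add]; rfl
            revert this
            generalize ρ k = g
            rcases g with z | z
            · intro _; exact ⟨z, rfl⟩
            · intro h0; exact absurd h0 sgn_sr
          · exact absurd hi (Int.not_even_iff_odd.2 hs)
        · exfalso
          rw [hi] at h1
          rcases zpow_cases (q T) ((sq _).trans qT2) l with ⟨-, hl⟩ | ⟨-, hl⟩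
          · rw [hl, mul_one] at h1
            exact hA ((hq A).1 h1.symm)
          · rw [hl, ← map_mul] at h1
            exact hAT ((hq _).1 h1.symm)
      have := dies e ⟨_, memY⟩ hY ρ (by
        intro k hk l hl
        obtain ⟨x, hx⟩ := rot k hk
        obtain ⟨y, hy⟩ := rot l hl
        rw [hx, hy, DihedralGroup.r_mul_r, DihedralGroup.r_mul_r, add_comm])
      change ρ (B * A⁻¹) = 1 at this
      rw [map_mul, map_inv, rA, rB] at this
      exact dih_ne this
    exact four hcard (q A) (q S) (q T) qA2 qS2 qT2 (mt (hq _).1 hA) (mt (hq _).1 hS)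
      (mt (hq _).1 hT) (by rw [← map_mul]; exact mt (hq _).1 hAS)
      (by rw [← map_mul]; exact mt (hq _).1 hAT) (by rw [← map_mul]; exact mt (hq _).1 hST)
      (by rw [← map_mul, ← map_mul]; exact mt (hq _).1 hAST)
  have hle : H ≤ K := by
    unfold H
    rw [Subgroup.closure_le]
    rintro x (rfl | rfl)
    · exact hA
    · change B ∈ K
      rw [← hq, qB, hq]; exact hA
  refine le_antisymm ?_ hle
  have := Subgroup.relIndex_mul_index hle
  rw [hK, H_index] at this
  exact Subgroup.relIndex_eq_one.1 (by omega)

private lemma uniq (K : Subgroup N') (hN : K.Normal) (hK : K.index = 4)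
    (e : Abelianization K ≃* Multiplicative ℤ) : K = H := by
  have hcard : Nat.card (N' ⧸ K) = 2 ^ 2 := hK
  have hcomm : ∀ x y : N' ⧸ K, x * y = y * x :=
    have : Fact (Nat.Prime 2) := ⟨Nat.prime_two⟩
    (IsPGroup.isMulCommutative_of_card_eq_prime_sq hcard).is_comm.comm
  let _ : CommGroup (N' ⧸ K) := { QuotientGroup.Quotient.group K with mul_comm := hcomm }
  exact uniq_aux K hK (QuotientGroup.mk' K) (fun n => QuotientGroup.eq_one_iff n) hK e

/-- `N'` has exactly one normal subgroup of index 4 whose abelianization is infinite cyclic. -/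
theorem N'_unique_index_four_normal_subgroup :
    ∃! K : Subgroup N', K.Normal ∧ K.index = 4 ∧
      Nonempty (Abelianization K ≃* Multiplicative ℤ) := by
  refine ⟨H, ⟨H_normal, H_index, H_ab⟩, ?_⟩
  rintro K ⟨hN, hK, ⟨e⟩⟩
  exact uniq K hN hK e
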